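/- arXiv:2412.00024 — 4 statements merged into one kernel-verified Lean document; each statement's English description precedes it below -/
import Mathlib

section
/- The sum over k >= 0 of (H_{3k+1} - H_k) / ((3k+1) * binomial(3k,k) * 2^{k+1}) equals π²/48 - (ln 2)²/10 + (2/5)·G, where G is Catalan's constant. -/
open Real

/-- Catalan's constant. -/
noncomputable def catalan' : ℝ := ∑' j : ℕ, (-1) ^ j / (2 * (j : ℝ) + 1) ^ 2

open MeasureTheory Set in
lemma aux_intg (p : ℝ → ℝ) (hp : ContinuousOn p (Icc 0 1)) :
    IntegrableOn (fun x => p x * (-log x)) (Ioo 0 1) := by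
  have h : IntegrableOn (fun x => -log x) (Ioo (0:ℝ) 1) := by
    have h1 : IntervalIntegrable (fun x => log x) volume 0 1 := intervalIntegral.intervalIntegrable_log'
    rw [intervalIntegrable_iff_integrableOn_Ioo_of_le zero_le_one] at h1
    exact h1.neg
  exact IntegrableOn.continuousOn_mul_of_subset hp h isCompact_Icc measurableSet_Ioo Ioo_subset_Icc_self

open MeasureTheory Set in
lemma aux_pow (n : ℕ) : ∫ x in Ioo (0:ℝ) 1, x ^ n * (-log x) = 1 / ((n:ℝ) + 1) ^ 2 := by
  have hn : (n:ℝ) + 1 ≠ 0 := by positivity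
  rw [← integral_Ioc_eq_integral_Ioo, ← intervalIntegral.integral_of_le zero_le_one]
  rw [intervalIntegral.integral_eq_sub_of_hasDerivAt_of_le zero_le_one
    (f := fun x => x ^ (n+1) / (n+1)^2 - x ^ n * (x * log x) / (n+1))]
  · simp
  · apply Continuous.continuousOn
    have := Real.continuous_mul_log
    fun_prop
  · intro x hx
    have hx0 : x ≠ 0 := hx.1.ne'
    have h1 : HasDerivAt (fun x : ℝ => x ^ (n+1) / (n+1)^2 - x ^ (n + 1) * log x / (n+1))
      (((n+1 : ℕ) : ℝ) * x ^ n / (n+1)^2 - (((n+1 : ℕ) : ℝ) * x ^ n * log x + x ^ (n+1) * x⁻¹) / (n+1)) x := by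
      have := hasDerivAt_pow (n+1) x
      exact (this.div_const _).sub ((this.mul (hasDerivAt_log hx0)).div_const _)
    convert! h1 using 1
    · funext y; ring
    · push_cast
      field_simp
      ring
  · rw [intervalIntegrable_iff_integrableOn_Ioo_of_le zero_le_one]
    exact aux_intg _ (by fun_prop)

open MeasureTheory Set in
lemma aux_beta (b : ℕ) : ∀ a : ℕ, ∫ x in Ioo (0:ℝ) 1, (x ^ a * (1 - x) ^ b) * (-log x) =
    (a.factorial * b.factorial : ℝ) / (a + b + 1).factorial *
      ((harmonic (a + b + 1) : ℝ) - (harmonic a : ℝ)) := by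
  induction b with
  | zero =>
    intro a
    simp only [pow_zero, mul_one, aux_pow]
    simp only [add_zero, harmonic_succ, Nat.factorial_succ]
    have : (a.factorial : ℝ) ≠ 0 := by positivity
    push_cast
    field_simp
    simp
  | succ b ih =>
    intro a
    have h : ∀ x : ℝ, (x ^ a * (1 - x) ^ (b+1)) * (-log x) =
      (x ^ a * (1 - x) ^ b) * (-log x) - (x ^ (a+1) * (1 - x) ^ b) * (-log x) := by
      intro x; ring
    simp only [h]
    rw [integral_sub (aux_intg _ (by fun_prop)) (aux_intg _ (by fun_prop)), ih a, ih (a+1)]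
    have e1 : a + 1 + b + 1 = (a + b + 1) + 1 := by ring
    have e2 : a + (b + 1) + 1 = (a + b + 1) + 1 := by ring
    rw [e1, e2, harmonic_succ (a+b+1), harmonic_succ a, Nat.factorial_succ (a+b+1),
      Nat.factorial_succ a, Nat.factorial_succ b]
    have : ((a+b+1).factorial : ℝ) ≠ 0 := by positivity
    have : (a:ℝ) + 1 ≠ 0 := by positivity
    have : (a:ℝ) + b + 1 + 1 ≠ 0 := by positivity
    push_cast
    field_simp
    ring

open MeasureTheory Set in
lemma aux_exch (c : ℕ → ℝ) (p : ℕ → ℝ → ℝ) (I : ℕ → ℝ) (g : ℝ → ℝ)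
    (hp : ∀ k, ContinuousOn (p k) (Icc 0 1)) (hp0 : ∀ k, ∀ x ∈ Ioo (0:ℝ) 1, 0 ≤ p k x)
    (hI : ∀ k, ∫ x in Ioo (0:ℝ) 1, p k x * (-log x) = I k)
    (hs : Summable fun k => |c k| * I k)
    (hg : ∀ x ∈ Ioo (0:ℝ) 1, HasSum (fun k => c k * p k x) (g x)) :
    HasSum (fun k => c k * I k) (∫ x in Ioo (0:ℝ) 1, g x * (-log x)) := by
  have key := hasSum_integral_of_summable_integral_norm (μ := volume.restrict (Ioo (0:ℝ) 1))
    (F := fun k x => c k * (p k x * (-log x)))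
    (fun k => (aux_intg _ (hp k)).const_mul (c k)) ?_
  · convert! key using 1
    · funext k
      rw [integral_const_mul, hI]
    · apply setIntegral_congr_fun measurableSet_Ioo
      intro x hx
      have := ((hg x hx).mul_right (-log x)).tsum_eq
      simp only [← this]
      congr 1; funext k; ring
  · convert! hs using 2 with k
    rw [← hI, ← integral_const_mul]
    apply setIntegral_congr_fun measurableSet_Ioo
    intro x hx
    have h1 := hp0 k x hx
    have h2 : 0 ≤ -log x := by
      have := Real.log_nonpos hx.1.le hx.2.le
      linarith
    simp only [norm_mul, Real.norm_eq_abs]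
    rw [abs_of_nonneg h1, abs_of_nonneg h2]

lemma aux_z2 : HasSum (fun n : ℕ => 1 / ((n:ℝ) + 1) ^ 2) (π ^ 2 / 6) := by
  have := (hasSum_nat_add_iff' 1).mpr hasSum_zeta_two
  simpa using this

lemma HasSum.congr_fun_aux {f g : ℕ → ℝ} {a : ℝ} (hf : HasSum f a) (h : ∀ k, g k = f k) :
    HasSum g a := by
  rwa [funext h]

lemma aux_eta : HasSum (fun n : ℕ => (-1:ℝ) ^ n / ((n:ℝ) + 1) ^ 2) (π ^ 2 / 12) := by
  have h := aux_z2
  have hs : Summable (fun n : ℕ => (-1:ℝ) ^ n / ((n:ℝ) + 1) ^ 2) := by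
    apply Summable.of_norm_bounded h.summable
    intro n
    simp
  have hodd : HasSum (fun k : ℕ => 1 / (((2 * k + 1 : ℕ):ℝ) + 1) ^ 2) (π ^ 2 / 24) := by
    have h4 := h.mul_left (1/4)
    have e1 : (1/4 : ℝ) * (π ^ 2 / 6) = π ^ 2 / 24 := by ring
    rw [e1] at h4
    refine h4.congr_fun_aux ?_
    intro k; push_cast
    have : (k:ℝ) + 1 ≠ 0 := by positivity
    field_simp; ring
  -- the difference `1/(n+1)² - (-1)^n/(n+1)²` is supported on odd `n`
  have hd : HasSum (fun n : ℕ => 1 / ((n:ℝ) + 1) ^ 2 - (-1:ℝ) ^ n / ((n:ℝ) + 1) ^ 2) (0 + 2 * (π ^ 2 / 24)) := by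
    apply HasSum.even_add_odd
    · refine hasSum_zero.congr_fun_aux ?_
      intro k; simp
    · refine (hodd.mul_left 2).congr_fun_aux ?_
      intro k; rw [pow_succ (-1 : ℝ) (2 * k), pow_mul]; simp only [neg_one_sq, one_pow]; ring
  have := h.sub hd
  have e2 : π ^ 2 / 6 - (0 + 2 * (π ^ 2 / 24)) = π ^ 2 / 12 := by ring
  rw [e2] at this
  refine this.congr_fun_aux ?_
  intro n; ring

noncomputable def auxLi (x : ℝ) : ℝ := ∑' n : ℕ, x ^ (n + 1) / ((n:ℝ) + 1) ^ 2

open Set in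
lemma auxLi_cont : ContinuousOn auxLi (Icc 0 1) := by
  apply continuousOn_tsum (u := fun n : ℕ => 1 / ((n:ℝ) + 1) ^ 2) _ aux_z2.summable
  · intro n x hx
    rw [Real.norm_eq_abs, abs_of_nonneg (by have := hx.1; positivity)]
    gcongr
    exact pow_le_one₀ hx.1 hx.2
  · intro n; fun_prop

open Set in
lemma auxLi_deriv (x : ℝ) (hx : x ∈ Ioo (0:ℝ) 1) : HasDerivAt auxLi (-log (1 - x) / x) x := by
  obtain ⟨r, hr1, hr2⟩ := exists_between hx.2
  have h0 : 0 < r := hx.1.trans hr1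
  have key := hasDerivAt_tsum_of_isPreconnected (𝕜 := ℝ) (u := fun n : ℕ => r ^ n) (t := Ioo 0 r)
    (g := fun n x => x ^ (n + 1) / ((n:ℝ) + 1) ^ 2) (g' := fun n x => x ^ n / ((n:ℝ) + 1)) (y₀ := x) (y := x)
    (summable_geometric_of_lt_one h0.le hr2) isOpen_Ioo isPreconnected_Ioo ?_ ?_ ⟨hx.1, hr1⟩ ?_ ⟨hx.1, hr1⟩
  · convert! key using 1
    have h := (hasSum_pow_div_log_of_abs_lt_one (x := x) (by rw [abs_of_pos hx.1]; exact hx.2)).div_const x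
    rw [← h.tsum_eq]
    congr 1; funext n
    have := hx.1.ne'
    field_simp
    ring
  · intro n y hy
    have := (hasDerivAt_pow (n+1) y).div_const (((n:ℝ) + 1) ^ 2)
    convert! this using 1
    push_cast
    field_simp
  · intro n y hy
    have := hy.1
    rw [Real.norm_eq_abs, abs_of_nonneg (by positivity)]
    calc y ^ n / ((n:ℝ) + 1) ≤ y ^ n / 1 := by gcongr; simp
      _ ≤ r ^ n := by rw [div_one]; gcongr; exact hy.2.le
  · apply Summable.of_norm_bounded aux_z2.summable
    intro n
    have := hx.1
    rw [Real.norm_eq_abs, abs_of_nonneg (by positivity)]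
    gcongr
    exact pow_le_one₀ hx.1.le hx.2.le

open Set Filter Topology in
lemma aux_loglog : ContinuousOn (fun x : ℝ => log x * log (1 - x)) (Icc 0 (1/2)) := by
  intro x hx
  rcases hx.1.eq_or_lt with h | h
  · subst h
    have hz : Tendsto (fun x : ℝ => 2 * |x * log x|) (𝓝[Icc 0 (1/2)] 0) (𝓝 0) := by
      have : Continuous (fun x : ℝ => 2 * |x * log x|) := by
        have := Real.continuous_mul_log
        fun_prop
      have := (this.tendsto 0).mono_left (nhdsWithin_le_nhds (s := Icc (0:ℝ) (1/2)))
      simpa using this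
    unfold ContinuousWithinAt
    simp only [log_zero, zero_mul]
    apply squeeze_zero_norm' _ hz
    filter_upwards [self_mem_nhdsWithin] with y hy
    have hy1 : 0 < 1 - y := by linarith [hy.2]
    have h1 : log (1 - y) ≤ 0 := Real.log_nonpos hy1.le (by linarith [hy.1])
    have h2 : -log (1 - y) ≤ 2 * y := by
      have := Real.one_sub_inv_le_log_of_pos hy1
      have h3 : (1 - y)⁻¹ - 1 ≤ 2 * y := by
        rw [inv_eq_one_div, div_sub_one hy1.ne', div_le_iff₀ hy1]
        nlinarith [hy.1, hy.2]
      linarith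
    rw [norm_mul, abs_mul, Real.norm_eq_abs, Real.norm_eq_abs, abs_of_nonpos h1, abs_of_nonneg hy.1]
    nlinarith [abs_nonneg (log y)]
  · apply ContinuousAt.continuousWithinAt
    have h2 : 1 - x ≠ 0 := by linarith [hx.2]
    exact (continuousAt_log h.ne').mul ((continuousAt_const.sub continuousAt_id).log h2)

open Set in
lemma auxLi_half : auxLi (1/2) = π ^ 2 / 12 - log 2 ^ 2 / 2 := by
  have hcont : ContinuousOn (fun x => auxLi x + auxLi (1 - x) + log x * log (1 - x)) (Icc 0 (1/2)) := by
    refine ContinuousOn.add (ContinuousOn.add ?_ ?_) aux_loglog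
    · exact auxLi_cont.mono (Icc_subset_Icc le_rfl (by norm_num))
    · apply auxLi_cont.comp (by fun_prop)
      intro x hx
      constructor <;> linarith [hx.1, hx.2]
  have hder : ∀ x ∈ Ioo (0:ℝ) (1/2),
      HasDerivAt (fun x => auxLi x + auxLi (1 - x) + log x * log (1 - x)) 0 x := by
    intro x hx
    have hx1 : x ∈ Ioo (0:ℝ) 1 := ⟨hx.1, by linarith [hx.2]⟩
    have hx2 : 1 - x ∈ Ioo (0:ℝ) 1 := ⟨by linarith [hx.2], by linarith [hx.1]⟩
    have hs : HasDerivAt (fun x : ℝ => 1 - x) (-1) x := by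
      simpa using (hasDerivAt_id x).const_sub 1
    have d1 := auxLi_deriv x hx1
    have d2 := (auxLi_deriv _ hx2).comp x hs
    have d3 := (hasDerivAt_log hx.1.ne').mul (hs.log hx2.1.ne')
    convert! (d1.add d2).add d3 using 1
    have := hx1.1.ne'
    have := hx2.1.ne'
    have e : 1 - (1 - x) = x := by ring
    rw [e]
    field_simp
    ring
  obtain ⟨c, hc, h⟩ := exists_hasDerivAt_eq_slope
    (fun x => auxLi x + auxLi (1 - x) + log x * log (1 - x)) (fun _ => 0)
    (a := 0) (b := 1/2) (by norm_num) hcont hder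
  have h1 : auxLi 1 = π ^ 2 / 6 := by
    simp only [auxLi, one_pow]; exact aux_z2.tsum_eq
  have h0 : auxLi 0 = 0 := by simp [auxLi]
  have hl : log (1/2) = - log 2 := by simp
  have e : (1:ℝ) - 1/2 = 1/2 := by norm_num
  simp only [e, sub_zero, h1, h0, hl, log_zero] at h
  linarith

open MeasureTheory Set in
lemma aux_A : ∫ x in Ioo (0:ℝ) 1, 1 / (2 - x) * (-log x) = π ^ 2 / 12 - log 2 ^ 2 / 2 := by
  have hb : ∀ n : ℕ, ((1:ℝ)/2) ^ (n+1) * (1 / ((n:ℝ) + 1) ^ 2) = (1/2) ^ (n + 1) / ((n:ℝ) + 1) ^ 2 := by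
    intro n; ring
  have h := aux_exch (fun n => (1/2) ^ (n+1)) (fun n x => x ^ n) (fun n => 1 / ((n:ℝ) + 1) ^ 2)
    (fun x => 1 / (2 - x)) (fun k => by fun_prop) (fun k x hx => pow_nonneg hx.1.le _) aux_pow ?_ ?_
  · rw [← h.tsum_eq, ← auxLi_half, auxLi]
    simp only [hb]
  · apply Summable.of_norm_bounded aux_z2.summable
    intro n
    rw [Real.norm_eq_abs, abs_of_nonneg (by positivity), abs_of_nonneg (by positivity)]
    apply mul_le_of_le_one_left (by positivity)
    exact pow_le_one₀ (by norm_num) (by norm_num)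
  · intro x hx
    have := (hasSum_geometric_of_lt_one (r := x / 2) (by linarith [hx.1]) (by linarith [hx.2])).mul_left (1/2)
    convert! this using 1
    · funext n; rw [div_pow, div_pow]; field_simp; ring
    · have : 2 - x ≠ 0 := by linarith [hx.2]
      have : 1 - x / 2 ≠ 0 := by linarith [hx.2]
      field_simp

lemma aux_geo (x : ℝ) (hx : x ∈ Set.Ioo (0:ℝ) 1) :
    HasSum (fun n : ℕ => (-1:ℝ) ^ n * x ^ (2 * n)) (1 / (1 + x ^ 2)) := by
  have := hasSum_geometric_of_abs_lt_one (r := - x ^ 2)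
    (by rw [abs_neg, abs_of_nonneg (by positivity)]; nlinarith [hx.1, hx.2])
  convert! this using 1
  · funext n; rw [neg_pow (x ^ 2), pow_mul]
  · simp

open MeasureTheory Set in
lemma aux_B : ∫ x in Ioo (0:ℝ) 1, x / (1 + x ^ 2) * (-log x) = π ^ 2 / 48 := by
  have hb : ∀ n : ℕ, 1 / (((2 * n + 1 : ℕ):ℝ) + 1) ^ 2 = 1 / 4 * (1 / ((n:ℝ) + 1) ^ 2) := by
    intro n; push_cast
    have : (n:ℝ) + 1 ≠ 0 := by positivity
    field_simp; ring
  have h := aux_exch (fun n => (-1) ^ n) (fun n x => x ^ (2 * n + 1)) (fun n => 1 / (((2 * n + 1 : ℕ):ℝ) + 1) ^ 2)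
    (fun x => x / (1 + x ^ 2)) (fun k => by fun_prop) (fun k x hx => pow_nonneg hx.1.le _)
    (fun k => aux_pow _) ?_ ?_
  · refine h.unique ?_
    convert! aux_eta.mul_left (1/4) using 1
    · funext n; rw [hb]; ring
    · ring
  · simp only [hb, abs_pow, abs_neg, abs_one, one_pow, one_mul]
    exact aux_z2.summable.mul_left _
  · intro x hx
    convert! (aux_geo x hx).mul_left x using 1
    · funext n; ring
    · ring

open MeasureTheory Set in
lemma aux_C : ∫ x in Ioo (0:ℝ) 1, 1 / (1 + x ^ 2) * (-log x) = catalan' := by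
  have h := aux_exch (fun n => (-1) ^ n) (fun n x => x ^ (2 * n)) (fun n => 1 / (((2 * n : ℕ):ℝ) + 1) ^ 2)
    (fun x => 1 / (1 + x ^ 2)) (fun k => by fun_prop) (fun k x hx => pow_nonneg hx.1.le _)
    (fun k => aux_pow _) ?_ aux_geo
  · rw [← h.tsum_eq, catalan']
    congr 1; funext n; push_cast; ring
  · simp only [abs_pow, abs_neg, abs_one, one_pow, one_mul]
    exact aux_z2.summable.comp_injective (i := fun k : ℕ => 2 * k) (fun a b hab => by simpa using hab)

open MeasureTheory Set in
lemma aux_main : HasSum (fun k : ℕ => (1/2:ℝ) ^ (k+1) *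
    (∫ x in Ioo (0:ℝ) 1, (x ^ k * (1 - x) ^ (2 * k)) * (-log x)))
    (∫ x in Ioo (0:ℝ) 1, 1 / (2 - x * (1 - x) ^ 2) * (-log x)) := by
  have hlog : ∀ x ∈ Ioo (0:ℝ) 1, 0 ≤ -log x := fun x hx => by
    have := Real.log_nonpos hx.1.le hx.2.le
    linarith
  apply aux_exch (fun k => (1/2:ℝ) ^ (k+1)) (fun k x => x ^ k * (1 - x) ^ (2 * k)) _ _
    (fun k => by fun_prop) _ (fun k => rfl)
  · have hg : Summable (fun k : ℕ => (1/2:ℝ) ^ (k+1)) := by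
      have := summable_geometric_of_lt_one (r := (1/2:ℝ)) (by norm_num) (by norm_num)
      exact (summable_nat_add_iff 1).mpr this
    apply Summable.of_norm_bounded hg
    intro k
    have i0 : 0 ≤ ∫ x in Ioo (0:ℝ) 1, (x ^ k * (1 - x) ^ (2 * k)) * (-log x) := by
      apply setIntegral_nonneg measurableSet_Ioo
      intro x hx
      have := hlog x hx
      have := hx.1.le
      have : 0 ≤ 1 - x := by linarith [hx.2]
      positivity
    have i1 : ∫ x in Ioo (0:ℝ) 1, (x ^ k * (1 - x) ^ (2 * k)) * (-log x) ≤ 1 := by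
      have := aux_pow 0
      simp only [Nat.cast_zero, zero_add, one_pow, div_one] at this
      refine le_trans ?_ this.le
      apply setIntegral_mono_on (aux_intg _ (by fun_prop)) (aux_intg _ (by fun_prop)) measurableSet_Ioo
      intro x hx
      apply mul_le_mul_of_nonneg_right _ (hlog x hx)
      have h0 := hx.1.le
      have h1 : 0 ≤ 1 - x := by linarith [hx.2]
      rw [pow_zero]
      exact mul_le_one₀ (pow_le_one₀ h0 hx.2.le) (by positivity) (pow_le_one₀ h1 (by linarith))
    rw [Real.norm_eq_abs, abs_of_nonneg (by positivity), abs_of_nonneg (by positivity)]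
    exact mul_le_of_le_one_right (by positivity) i1
  · intro x hx
    have h0 := hx.1.le
    have h1 : 0 ≤ 1 - x := by linarith [hx.2]
    have hq : x * (1 - x) ^ 2 ≤ 1 :=
      mul_le_one₀ hx.2.le (by positivity) (pow_le_one₀ h1 (by linarith))
    have := (hasSum_geometric_of_lt_one (r := x * (1 - x) ^ 2 / 2) (by positivity) (by linarith)).mul_left (1/2)
    convert! this using 1
    · funext n; rw [div_pow, div_pow, mul_pow, ← pow_mul]; field_simp; ring
    · have : 2 - x * (1 - x) ^ 2 ≠ 0 := by linarith
      have : 1 - x * (1 - x) ^ 2 / 2 ≠ 0 := by linarith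
      field_simp
  · intro k x hx
    have h0 := hx.1.le
    have h1 : 0 ≤ 1 - x := by linarith [hx.2]
    positivity

open MeasureTheory Set in
lemma aux_int : ∫ x in Ioo (0:ℝ) 1, 1 / (2 - x * (1 - x) ^ 2) * (-log x) =
    π ^ 2 / 48 - (Real.log 2) ^ 2 / 10 + (2 / 5) * catalan' := by
  have c1 : ContinuousOn (fun x : ℝ => 1 / (2 - x)) (Icc 0 1) := by
    apply ContinuousOn.div (by fun_prop) (by fun_prop)
    intro x hx; linarith [hx.2]
  have c2 : ContinuousOn (fun x : ℝ => x / (1 + x ^ 2)) (Icc 0 1) := by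
    apply ContinuousOn.div (by fun_prop) (by fun_prop)
    intro x hx; positivity
  have c3 : ContinuousOn (fun x : ℝ => 1 / (1 + x ^ 2)) (Icc 0 1) := by
    apply ContinuousOn.div (by fun_prop) (by fun_prop)
    intro x hx; positivity
  have e : ∫ x in Ioo (0:ℝ) 1, 1 / (2 - x * (1 - x) ^ 2) * (-log x) =
      ∫ x in Ioo (0:ℝ) 1, (1/5 * (1 / (2 - x) * (-log x)) + 1/5 * (x / (1 + x ^ 2) * (-log x))
        + 2/5 * (1 / (1 + x ^ 2) * (-log x))) := by
    apply setIntegral_congr_fun measurableSet_Ioo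
    intro x hx
    have h1 : 2 - x ≠ 0 := by linarith [hx.2]
    have h2 : 1 + x ^ 2 ≠ 0 := by positivity
    have h3 : 2 - x * (1 - x) ^ 2 = (2 - x) * (1 + x ^ 2) := by ring
    simp only [h3]
    field_simp
    ring
  have i1 := (aux_intg _ c1).const_mul (1/5)
  have i2 := (aux_intg _ c2).const_mul (1/5)
  have i3 := (aux_intg _ c3).const_mul (2/5)
  rw [e, integral_add (f := fun x => 1/5 * (1 / (2 - x) * (-log x)) + 1/5 * (x / (1 + x ^ 2) * (-log x))) (i1.add i2) i3, integral_add i1 i2, integral_const_mul, integral_const_mul,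
    integral_const_mul, aux_A, aux_B, aux_C]
  ring

theorem stmt_6 :
    ∑' k : ℕ, ((harmonic (3 * k + 1) : ℝ) - (harmonic k : ℝ)) /
        ((3 * k + 1) * (Nat.choose (3 * k) k : ℝ) * 2 ^ (k + 1)) =
      π ^ 2 / 48 - (Real.log 2) ^ 2 / 10 + (2 / 5) * catalan' := by
  rw [← aux_int, ← aux_main.tsum_eq]
  congr 1
  funext k
  rw [aux_beta]
  have e : k + 2 * k + 1 = 3 * k + 1 := by ring
  have hc : (Nat.choose (3 * k) k : ℝ) * k.factorial * (2 * k).factorial = (3 * k).factorial := by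
    have := Nat.choose_mul_factorial_mul_factorial (n := 3 * k) (k := k) (by omega)
    have e2 : 3 * k - k = 2 * k := by omega
    rw [e2] at this
    exact_mod_cast this
  have h0 : (Nat.choose (3 * k) k : ℝ) ≠ 0 := by
    exact_mod_cast (Nat.choose_pos (by omega)).ne'
  rw [e, Nat.factorial_succ]
  push_cast
  rw [← hc, div_pow, one_pow]
  have : (k.factorial : ℝ) ≠ 0 := by positivity
  have : ((2 * k).factorial : ℝ) ≠ 0 := by positivity
  have : 3 * (k:ℝ) + 1 ≠ 0 := by positivity
  field_simp
end

section
/- For every complex λ not in [0,1] and every integer j >= 1, the integral from 0 to 1 of ln(x)/(x-λ)^{j+1} dx equals ((-1)^j/j) * sum_{p=1}^{j-1} (1/(p λ^{j-p})) * (1/(λ-1)^p - 1/λ^p) - ((-1)^j/(j λ^j)) * ln((λ-1)/λ). -/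
theorem aux_slit (lam : ℂ) (hlam : ∀ t : ℝ, t ∈ Set.Icc (0:ℝ) 1 → (t : ℂ) ≠ lam)
    (x : ℝ) (hx : x ∈ Set.Icc (0:ℝ) 1) : ((lam - x) / lam) ∈ Complex.slitPlane := by
  have h0 : lam ≠ 0 := by
    have := hlam 0 (by simp)
    simpa using this.symm
  rw [Complex.mem_slitPlane_iff_not_le_zero]
  intro h
  rw [Complex.le_def] at h
  obtain ⟨hre, him⟩ := h
  set s := ((lam - x) / lam).re with hs
  have e : (lam - x) / lam = (s : ℂ) := Complex.ext (by simp [hs]) (by simpa using him)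
  simp only [Complex.zero_re] at hre
  have h1 : (1 : ℝ) - s > 0 := by linarith
  have h1c : ((1 : ℂ) - s) ≠ 0 := by exact_mod_cast h1.ne'
  apply hlam (x / (1 - s))
  · constructor
    · exact div_nonneg hx.1 h1.le
    · rw [div_le_one h1]; linarith [hx.2]
  · push_cast
    rw [div_eq_iff h0] at e
    rw [div_eq_iff h1c]
    linear_combination -e

theorem aux_K (lam : ℂ) (x : ℂ) (h0 : lam ≠ 0) (hx : x - lam ≠ 0) (m : ℕ) :
    -(((x - lam)⁻¹) ^ (m+1) - ((-lam)⁻¹) ^ (m+1)) =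
      x * ∑ p ∈ Finset.range (m+1), ((x - lam)⁻¹) ^ (p+1) * ((-lam)⁻¹) ^ (m+1-p) := by
  rw [← geom_sum₂_mul]
  have : (x - lam)⁻¹ - (-lam)⁻¹ = -x * ((x - lam)⁻¹ * (-lam)⁻¹) := by
    field_simp
    ring
  rw [this, Finset.sum_mul, Finset.mul_sum, ← Finset.sum_neg_distrib]
  refine Finset.sum_congr rfl fun p hp => ?_
  have hp' := Finset.mem_range.1 hp
  have : m + 1 - p = (m + 1 - 1 - p) + 1 := by omega
  rw [this, pow_succ, pow_succ]
  ring

theorem stmt_12 (lam : ℂ) (hlam : ∀ t : ℝ, t ∈ Set.Icc (0:ℝ) 1 → (t : ℂ) ≠ lam)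
    (j : ℕ) (hj : 1 ≤ j) :
    ∫ x in (0:ℝ)..1, (Real.log x : ℂ) / ((x : ℂ) - lam) ^ (j + 1) =
      ((-1) ^ j / (j : ℂ)) * ∑ p ∈ Finset.Icc 1 (j - 1),
          (1 / ((p : ℂ) * lam ^ (j - p))) * (1 / (lam - 1) ^ p - 1 / lam ^ p) -
        ((-1) ^ j / ((j : ℂ) * lam ^ j)) * Complex.log ((lam - 1) / lam) := by
  obtain ⟨m, rfl⟩ : ∃ m, j = m + 1 := ⟨j - 1, by omega⟩
  have h0 : lam ≠ 0 := by
    have := hlam 0 (by simp)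
    simpa using this.symm
  have hl1 : lam - 1 ≠ 0 := by
    have := hlam 1 (by simp)
    simpa [sub_eq_zero] using this.symm
  have hne : ∀ x ∈ Set.Icc (0:ℝ) 1, (x : ℂ) - lam ≠ 0 := fun x hx => sub_ne_zero.2 (hlam x hx)
  have hm : ((m : ℂ) + 1) ≠ 0 := by exact_mod_cast Nat.succ_ne_zero m
  have hIcc : Finset.Icc 1 (m + 1 - 1) = Finset.Ico 1 (m + 1) := by
    ext; simp
  rw [hIcc, Finset.sum_Ico_eq_sum_range]
  set b : ℂ := (-lam)⁻¹ with hb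
  let K : ℝ → ℂ := fun x => ∑ p ∈ Finset.range (m+1), (((x:ℂ) - lam)⁻¹) ^ (p+1) * b ^ (m+1-p)
  let H : ℝ → ℂ := fun x => - (b ^ (m+1) * Complex.log ((lam - x) / lam)) +
    ∑ p ∈ Finset.range m, b ^ (m - p) / ((p : ℂ) + 1) * (((x:ℂ) - lam)⁻¹) ^ (p+1)
  let G : ℝ → ℂ := fun x => -((((x:ℂ) - lam)⁻¹) ^ (m+1) - b ^ (m+1))
  let F : ℝ → ℂ := fun x => ((m : ℂ) + 1)⁻¹ * ((Real.log x : ℂ) * G x + H x)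
  have hGK : ∀ x ∈ Set.Icc (0:ℝ) 1, G x = x * K x := fun x hx => aux_K lam x h0 (hne x hx) m
  have hinv : ∀ x ∈ Set.Icc (0:ℝ) 1, HasDerivAt (fun y : ℝ => ((y:ℂ) - lam)⁻¹)
      (-(((x:ℂ) - lam)⁻¹)^2) x := by
    intro x hx
    have := (((hasDerivAt_id x).ofReal_comp.sub_const lam).inv (hne x hx))
    refine HasDerivAt.congr_deriv this ?_
    simp [neg_div]
  have hH : ∀ x ∈ Set.Icc (0:ℝ) 1, HasDerivAt H (- K x) x := by
    intro x hx
    have hl : HasDerivAt (fun y : ℝ => Complex.log ((lam - y) / lam)) (((x:ℂ) - lam)⁻¹) x := by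
      have h1 := (((hasDerivAt_id x).ofReal_comp.const_sub lam).div_const lam).clog_real
        (aux_slit lam hlam x hx)
      refine HasDerivAt.congr_deriv h1 ?_
      have h2 := hne x hx
      have h3 : lam - x ≠ 0 := by rw [← neg_sub]; exact neg_ne_zero.2 h2
      simp only [id, Complex.ofReal_one]
      rw [← neg_sub lam (x:ℂ), inv_neg]
      field_simp
    have hs : HasDerivAt (fun x : ℝ => ∑ p ∈ Finset.range m,
        b ^ (m - p) / ((p : ℂ) + 1) * (((x:ℂ) - lam)⁻¹) ^ (p+1))
        (∑ p ∈ Finset.range m, -((((x:ℂ) - lam)⁻¹) ^ (p+1+1) * b ^ (m - p))) x := by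
      apply HasDerivAt.fun_sum
      intro p hp
      have := ((hinv x hx).pow (p+1)).const_mul (b ^ (m - p) / ((p : ℂ) + 1))
      refine HasDerivAt.congr_deriv this ?_
      have hp1 : ((p : ℂ) + 1) ≠ 0 := by exact_mod_cast Nat.succ_ne_zero p
      generalize ((x:ℂ) - lam)⁻¹ = a
      simp only [Nat.add_sub_cancel]
      push_cast
      field_simp
      ring
    have := (hl.const_mul (b ^ (m+1))).neg.add hs
    refine HasDerivAt.congr_deriv this ?_
    simp only [K]
    rw [Finset.sum_range_succ', Finset.sum_neg_distrib]
    simp only [Nat.add_sub_add_right, Nat.sub_zero]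
    ring
  have hic : ContinuousOn (fun y : ℝ => ((y:ℂ) - lam)⁻¹) (Set.Icc 0 1) :=
    fun x hx => (hinv x hx).continuousAt.continuousWithinAt
  have hKc : ContinuousOn K (Set.Icc 0 1) := by
    apply continuousOn_finsetSum
    intro p hp
    exact (hic.pow _).mul continuousOn_const
  have hHc : ContinuousOn H (Set.Icc 0 1) :=
    fun x hx => (hH x hx).continuousAt.continuousWithinAt
  have hFc : ContinuousOn F (Set.Icc 0 1) := by
    have hc : ContinuousOn (fun x : ℝ => ((m : ℂ) + 1)⁻¹ *
        (((x * Real.log x : ℝ) : ℂ) * K x + H x)) (Set.Icc 0 1) := by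
      refine continuousOn_const.mul (ContinuousOn.add (ContinuousOn.mul ?_ hKc) hHc)
      exact (Complex.continuous_ofReal.comp Real.continuous_mul_log).continuousOn
    refine hc.congr fun x hx => ?_
    simp only [F, hGK x hx]
    push_cast
    ring
  have hFd : ∀ x ∈ Set.Ioo (0:ℝ) 1, HasDerivAt F
      ((Real.log x : ℂ) / ((x : ℂ) - lam) ^ (m + 1 + 1)) x := by
    intro x hx
    have hx' := Set.Ioo_subset_Icc_self hx
    have hG : HasDerivAt G (((m:ℂ)+1) * (((x:ℂ) - lam)⁻¹) ^ (m+1+1)) x := by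
      have := (((hinv x hx').pow (m+1)).sub_const (b ^ (m+1))).neg
      refine HasDerivAt.congr_deriv this ?_
      simp only [Nat.add_sub_cancel]
      push_cast
      ring
    have hlog := (Real.hasDerivAt_log hx.1.ne').ofReal_comp
    have := ((hlog.mul hG).add (hH x hx')).const_mul (((m : ℂ) + 1)⁻¹)
    refine HasDerivAt.congr_deriv this ?_
    have hxc : (x : ℂ) ≠ 0 := by exact_mod_cast hx.1.ne'
    rw [hGK x hx', div_eq_mul_inv, ← inv_pow]
    push_cast
    field_simp
    ring
  have hint : IntervalIntegrable (fun x : ℝ => (Real.log x : ℂ) / ((x : ℂ) - lam) ^ (m + 1 + 1))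
      MeasureTheory.volume 0 1 := by
    have h1 : IntervalIntegrable (fun x : ℝ => (Real.log x : ℂ)) MeasureTheory.volume 0 1 := by
      have := (intervalIntegral.intervalIntegrable_log' (a := 0) (b := 1))
      exact ⟨this.1.ofReal, this.2.ofReal⟩
    have h2 := h1.mul_continuousOn (g := fun x : ℝ => (((x : ℂ) - lam)⁻¹) ^ (m + 1 + 1)) (by
      rw [Set.uIcc_of_le zero_le_one]
      exact hic.pow _)
    simpa only [div_eq_mul_inv, inv_pow] using h2
  rw [intervalIntegral.integral_eq_sub_of_hasDerivAt_of_le zero_le_one hFc hFd hint]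
  simp only [F, H, Real.log_one, Real.log_zero, Complex.ofReal_zero, Complex.ofReal_one, zero_mul,
    zero_add, sub_zero, div_self h0, Complex.log_one, mul_zero, neg_zero, zero_sub]
  have hs : ∀ p ∈ Finset.range m, (1 / (((1 + p : ℕ) : ℂ) * lam ^ (m + 1 - (1 + p)))) *
      (1 / (lam - 1) ^ (1 + p) - 1 / lam ^ (1 + p)) = (-1) ^ (m+1) *
      (b ^ (m - p) / ((p : ℂ) + 1) * ((1 - lam)⁻¹) ^ (p+1) -
       b ^ (m - p) / ((p : ℂ) + 1) * b ^ (p+1)) := by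
    intro p hp
    obtain ⟨k, rfl⟩ := Nat.exists_eq_add_of_lt (Finset.mem_range.1 hp)
    have e1 : p + k + 1 + 1 - (1 + p) = k + 1 := by omega
    have e2 : p + k + 1 - p = k + 1 := by omega
    have e3 : (1 - lam)⁻¹ = -1 * (lam - 1)⁻¹ := by rw [← neg_sub, inv_neg]; ring
    have e4 : b = -1 * lam⁻¹ := by rw [hb, inv_neg]; ring
    have e5 : ((-1:ℂ)) ^ (p + k + 1 + 1) * ((-1) ^ (k+1) * (-1) ^ (p+1)) = 1 := by
      rw [← pow_add, ← pow_add]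
      exact Even.neg_one_pow ⟨p + k + 1 + 1, by ring⟩
    rw [e1, e2, e3, e4, mul_pow, mul_pow, mul_pow, add_comm 1 p]
    push_cast
    simp only [one_div, mul_inv, inv_pow, div_eq_mul_inv]
    linear_combination (-((p:ℂ)+1)⁻¹ * (lam^(k+1))⁻¹ * (((lam-1)^(p+1))⁻¹ - (lam^(p+1))⁻¹)) * e5
  have hr : m + 1 - 1 = m := rfl
  rw [hr, Finset.sum_congr rfl hs, ← Finset.mul_sum, Finset.sum_sub_distrib]
  have e6 : ((-1:ℂ)) ^ (m + 1) * (-1) ^ (m+1) = 1 := by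
    rw [← mul_pow]; simp
  have e7 : b ^ (m+1) = (-1) ^ (m+1) * (lam ^ (m+1))⁻¹ := by
    rw [hb, inv_neg, neg_pow, inv_pow]
  rw [← hb, e7]
  push_cast
  simp only [div_eq_mul_inv, mul_inv]
  linear_combination (-((m:ℂ)+1)⁻¹ * (∑ p ∈ Finset.range m, b ^ (m - p) * ((p : ℂ) + 1)⁻¹ * ((1 - lam)⁻¹) ^ (p+1) - ∑ p ∈ Finset.range m, b ^ (m - p) * ((p : ℂ) + 1)⁻¹ * b ^ (p+1))) * e6
end

section
/- The sum over k >= 0 of (H_{3k+1} - H_k) * k / ((3k+1) * binomial(3k,k) * 2^{k+1}) equals 3π/100 - 3π²/400 + (3/25)·ln 2 + (9/250)·(ln 2)² - (13/125)·G. -/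
open Real

open MeasureTheory in
theorem logII {g : ℝ → ℝ} (hg : ContinuousOn g (Set.Icc 0 1)) :
    IntervalIntegrable (fun t => g t * log t) volume 0 1 := by
  apply IntervalIntegrable.continuousOn_mul intervalIntegral.intervalIntegrable_log'
  rwa [Set.uIcc_of_le zero_le_one]

theorem int_pow_log (n : ℕ) : ∫ t in (0:ℝ)..1, t ^ n * log t = -1 / ((n:ℝ) + 1) ^ 2 := by
  have hn : (n:ℝ) + 1 ≠ 0 := by positivity
  have := intervalIntegral.integral_eq_sub_of_hasDerivAt_of_le (a := 0) (b := 1)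
    (f := fun t : ℝ => t ^ n * (t * log t) / (n + 1) - t ^ (n + 1) / ((n:ℝ) + 1) ^ 2)
    (f' := fun t => t ^ n * log t) zero_le_one
    (by
      have := Real.continuous_mul_log
      fun_prop)
    (by
      intro x hx
      have hx0 : x ≠ 0 := hx.1.ne'
      have h1 : HasDerivAt (fun t : ℝ => t ^ (n + 1) * log t / (n + 1) - t ^ (n + 1) / ((n:ℝ) + 1) ^ 2) _ x :=
        (((hasDerivAt_pow (n + 1) x).mul (Real.hasDerivAt_log hx0)).div_const _).sub
        ((hasDerivAt_pow (n + 1) x).div_const _)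
      convert! h1 using 1
      · ext t; ring
      · simp only [Nat.add_sub_cancel]
        push_cast
        field_simp
        try ring)
    (logII (by fun_prop))
  rw [this]
  simp [neg_div]

theorem int_beta_log (b a : ℕ) : ∫ t in (0:ℝ)..1, (t ^ a * (1 - t) ^ b) * log t =
    -((a.factorial : ℝ) * b.factorial / (a + b + 1).factorial *
      ((harmonic (a + b + 1) : ℝ) - (harmonic a : ℝ))) := by
  induction b generalizing a with
  | zero =>
    simp only [pow_zero, mul_one, int_pow_log, add_zero, harmonic_succ, Nat.factorial_succ]
    have := Nat.factorial_ne_zero a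
    push_cast
    field_simp
    ring
  | succ b ih =>
    have : ∀ t : ℝ, (t ^ a * (1 - t) ^ (b + 1)) * log t =
      (t ^ a * (1 - t) ^ b) * log t - (t ^ (a + 1) * (1 - t) ^ b) * log t := by intro t; ring
    simp_rw [this]
    rw [intervalIntegral.integral_sub (logII (by fun_prop)) (logII (by fun_prop)), ih, ih]
    rw [show a + 1 + b + 1 = (a + b + 1) + 1 by ring, show a + (b + 1) + 1 = (a + b + 1) + 1 by ring]
    simp only [harmonic_succ a, harmonic_succ (a + b + 1), Nat.factorial_succ (a + b + 1),
      Nat.factorial_succ a, Nat.factorial_succ b]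
    have := Nat.factorial_ne_zero (a + b + 1)
    push_cast
    field_simp
    ring

open MeasureTheory in
theorem ser (m p : ℕ) (hm : 1 ≤ m) :
    HasSum (fun j : ℕ => (-1 : ℝ) ^ j * (-1 / ((m * j + p : ℕ) + 1 : ℝ) ^ 2))
      (∫ t in (0:ℝ)..1, t ^ p / (1 + t ^ m) * log t) := by
  have hint : ∀ n : ℕ, IntegrableOn (fun t : ℝ => t ^ n * log t) (Set.Ioc 0 1) := fun n =>
    (intervalIntegrable_iff_integrableOn_Ioc_of_le zero_le_one).1 (logII (by fun_prop))
  have hnorm : ∀ n : ℕ, ∫ t in Set.Ioc (0:ℝ) 1, ‖t ^ n * log t‖ = 1 / ((n:ℝ) + 1) ^ 2 := by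
    intro n
    have : ∫ t in Set.Ioc (0:ℝ) 1, ‖t ^ n * log t‖ = ∫ t in Set.Ioc (0:ℝ) 1, -(t ^ n * log t) := by
      apply setIntegral_congr_fun measurableSet_Ioc
      intro t ht
      have : log t ≤ 0 := Real.log_nonpos ht.1.le ht.2
      have h2 : 0 ≤ t ^ n := pow_nonneg ht.1.le n
      simp only [Real.norm_eq_abs]
      rw [abs_of_nonpos (by nlinarith)]
    rw [this, integral_neg, ← intervalIntegral.integral_of_le zero_le_one, int_pow_log]
    ring
  have := hasSum_integral_of_summable_integral_norm (μ := volume.restrict (Set.Ioc (0:ℝ) 1))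
    (F := fun (j : ℕ) (t : ℝ) => (-1) ^ j * (t ^ (m * j + p) * log t))
    (fun j => (hint _).const_mul _)
    (by
      simp only [norm_mul (_ ^ _ : ℝ) (_ * _), norm_pow, norm_neg, norm_one, one_pow, one_mul, hnorm]
      have h := (summable_nat_add_iff 1).2 hasSum_zeta_two.summable
      refine Summable.of_nonneg_of_le (fun j => by positivity) (fun j => ?_) h
      have : ((j + 1 : ℕ) : ℝ) ≤ ((m * j + p : ℕ) : ℝ) + 1 := by
        have : j + 1 ≤ m * j + p + 1 := by nlinarith
        exact_mod_cast this
      gcongr)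
  convert! this using 1
  · ext j
    rw [integral_const_mul, ← intervalIntegral.integral_of_le zero_le_one, int_pow_log]
  · rw [intervalIntegral.integral_of_le zero_le_one]
    rw [MeasureTheory.integral_Ioc_eq_integral_Ioo, MeasureTheory.integral_Ioc_eq_integral_Ioo]
    apply setIntegral_congr_fun measurableSet_Ioo
    intro t ht
    have hz : ‖-(t ^ m)‖ < 1 := by
      rw [norm_neg, norm_pow, Real.norm_eq_abs, abs_of_pos ht.1]
      exact pow_lt_one₀ ht.1.le ht.2 (by omega)
    have h := ((hasSum_geometric_of_norm_lt_one hz).mul_left (t ^ p * log t)).tsum_eq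
    simp only
    rw [show t ^ p / (1 + t ^ m) * log t = t ^ p * log t * (1 - -t ^ m)⁻¹ by
      rw [sub_neg_eq_add]; ring, ← h]
    congr 1; ext j
    rw [neg_pow, pow_add, pow_mul]; ring

theorem eta_two : HasSum (fun j : ℕ => (-1 : ℝ) ^ j * (1 / ((j:ℝ) + 1) ^ 2)) (π ^ 2 / 12) := by
  have h := hasSum_zeta_two
  have h1 : HasSum (fun j : ℕ => 1 / ((j:ℝ) + 1) ^ 2) (π ^ 2 / 6) := by
    have := (hasSum_nat_add_iff' 1).2 h
    simpa using this
  have ho : HasSum (fun j : ℕ => 1 / (((2 * j + 1 : ℕ):ℝ) + 1) ^ 2) (π ^ 2 / 24) := by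
    convert! h1.mul_left (1 / 4) using 1
    · ext j
      push_cast
      field_simp
      ring
    · ring
  have hes : Summable (fun j : ℕ => 1 / (((2 * j : ℕ):ℝ) + 1) ^ 2) :=
    h1.summable.comp_injective (i := fun j => 2 * j) (fun a b h => by simpa using h)
  have he := hes.hasSum
  have hv := (he.even_add_odd (f := fun j : ℕ => 1 / ((j:ℝ) + 1) ^ 2) ho).unique h1
  have key := HasSum.even_add_odd (f := fun j : ℕ => (-1 : ℝ) ^ j * (1 / ((j:ℝ) + 1) ^ 2))
    (by simpa [pow_mul] using he) (m' := -(π ^ 2 / 24))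
    (by simpa [pow_mul, pow_succ] using ho.neg)
  convert! key using 1
  have : ∑' j : ℕ, 1 / (((2 * j : ℕ):ℝ) + 1) ^ 2 = π ^ 2 / 8 := by linarith
  push_cast at this ⊢
  simp only [one_div] at this
  linarith

theorem I_G : ∫ t in (0:ℝ)..1, 1 / (1 + t ^ 2) * log t = - catalan' := by
  have := (ser 2 0 (by norm_num)).tsum_eq
  simp only [pow_zero] at this
  rw [← this, catalan', ← tsum_neg]
  congr 1; ext j; push_cast; ring

theorem I_1 : ∫ t in (0:ℝ)..1, 1 / (1 + t) * log t = - (π ^ 2 / 12) := by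
  have := ser 1 0 (by norm_num)
  simp only [pow_zero, pow_one] at this
  refine this.unique ?_
  convert! eta_two.neg using 1
  ext j; push_cast; ring

theorem I_2 : ∫ t in (0:ℝ)..1, t / (1 + t ^ 2) * log t = - (π ^ 2 / 48) := by
  have := ser 2 1 (by norm_num)
  simp only [pow_one] at this
  refine this.unique ?_
  convert! (eta_two.mul_left (-1 / 4)) using 1
  · ext j; push_cast; field_simp; ring
  · ring

open MeasureTheory in
theorem I_3 : ∫ t in (0:ℝ)..1, 1 / (2 - t) * log t = log 2 ^ 2 / 2 - π ^ 2 / 12 := by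
  have c1 : ContinuousOn (fun x : ℝ => 1 / (1 + x)) (Set.Icc 0 1) := by
    apply ContinuousOn.div (by fun_prop) (by fun_prop)
    intro x hx
    have := hx.1
    positivity
  have c2 : ContinuousOn (fun x : ℝ => 1 / (1 + x) * (log 2 - log (1 + x))) (Set.Icc 0 1) := by
    refine c1.mul (continuousOn_const.sub (ContinuousOn.log (by fun_prop) ?_))
    intro x hx
    have := hx.1
    positivity
  have i2 : IntervalIntegrable (fun x : ℝ => 1 / (1 + x) * (log 2 - log (1 + x))) volume 0 1 := by
    apply ContinuousOn.intervalIntegrable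
    rwa [Set.uIcc_of_le zero_le_one]
  have e : ∀ x ∈ Set.Ioc (0:ℝ) 1,
      1 / (1 + x) * log x + 1 / (1 + x) * (log 2 - log (1 + x)) =
      ((fun u : ℝ => 1 / (2 - u) * log u) ∘ (fun s : ℝ => 2 * s / (1 + s))) x * (2 / (1 + x) ^ 2) := by
    intro x hx
    have h0 := hx.1
    have h1 : (1 + x) ≠ 0 := by positivity
    simp only [Function.comp]
    rw [Real.log_div (by positivity) h1, Real.log_mul (by norm_num) h0.ne']
    have : 2 - 2 * x / (1 + x) = 2 / (1 + x) := by field_simp; ring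
    rw [this]
    field_simp
    ring
  have isum := (logII c1).add i2
  have key := intervalIntegral.integral_comp_mul_deriv''' (a := 0) (b := 1)
    (f := fun s : ℝ => 2 * s / (1 + s)) (f' := fun s => 2 / (1 + s) ^ 2)
    (g := fun u => 1 / (2 - u) * log u)
    (by
      rw [Set.uIcc_of_le zero_le_one]
      apply ContinuousOn.div (by fun_prop) (by fun_prop)
      intro x hx
      have := hx.1
      positivity)
    (by
      intro x hx
      simp only [zero_le_one, inf_of_le_left, sup_of_le_right, Set.mem_Ioo] at hx
      have h0 := hx.1
      have h1 : (1 + x) ≠ 0 := by positivity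
      have := (((hasDerivAt_id x).const_mul 2).div ((hasDerivAt_id x).const_add 1) h1).hasDerivWithinAt (s := Set.Ioi x)
      convert! this using 1
      simp only [id]
      congr 1; ring)
    (by
      rintro _ ⟨x, hx, rfl⟩
      simp only [zero_le_one, inf_of_le_left, sup_of_le_right, Set.mem_Ioo] at hx
      have h0 := hx.1
      apply ContinuousAt.continuousWithinAt
      have h1 : 2 - 2 * x / (1 + x) ≠ 0 := by
        have : 2 - 2 * x / (1 + x) = 2 / (1 + x) := by field_simp; ring
        rw [this]; positivity
      refine ContinuousAt.mul (ContinuousAt.div (by fun_prop) (by fun_prop) h1)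
        (Real.continuousAt_log (by positivity)))
    (by
      have : IntegrableOn (fun u : ℝ => 1 / (2 - u) * log u) (Set.Icc 0 1) := by
        rw [integrableOn_Icc_iff_integrableOn_Ioc,
          ← intervalIntegrable_iff_integrableOn_Ioc_of_le zero_le_one]
        apply logII
        apply ContinuousOn.div (by fun_prop) (by fun_prop)
        intro x hx
        have := hx.2
        linarith
      apply this.mono_set
      rintro _ ⟨x, hx, rfl⟩
      rw [Set.uIcc_of_le zero_le_one] at hx
      have h0 := hx.1
      have h1 := hx.2
      refine ⟨by positivity, ?_⟩
      simp only
      rw [div_le_one (by positivity)]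
      linarith)
    (by
      rw [Set.uIcc_of_le zero_le_one, integrableOn_Icc_iff_integrableOn_Ioc]
      exact ((intervalIntegrable_iff_integrableOn_Ioc_of_le zero_le_one).1 isum).congr_fun
        e measurableSet_Ioc)
  have hf0 : (2 * (0:ℝ)) / (1 + 0) = 0 := by norm_num
  have hf1 : (2 * (1:ℝ)) / (1 + 1) = 1 := by norm_num
  rw [hf0, hf1] at key
  rw [← key]
  have k2 : ∫ x in (0:ℝ)..1, (1 / (1 + x) * log x + 1 / (1 + x) * (log 2 - log (1 + x))) =
      ∫ x in (0:ℝ)..1, ((fun u : ℝ => 1 / (2 - u) * log u) ∘ (fun s : ℝ => 2 * s / (1 + s))) x * (2 / (1 + x) ^ 2) := by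
    rw [intervalIntegral.integral_of_le zero_le_one, intervalIntegral.integral_of_le zero_le_one]
    exact setIntegral_congr_fun measurableSet_Ioc e
  rw [← k2, intervalIntegral.integral_add (logII c1) i2, I_1]
  have k3 := intervalIntegral.integral_eq_sub_of_hasDerivAt (a := 0) (b := 1)
    (f := fun x : ℝ => log 2 * log (1 + x) - log (1 + x) ^ 2 / 2)
    (f' := fun x : ℝ => 1 / (1 + x) * (log 2 - log (1 + x)))
    (by
      intro x hx
      rw [Set.uIcc_of_le zero_le_one] at hx
      have h0 := hx.1
      have h1 : (1 + x) ≠ 0 := by positivity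
      have hl : HasDerivAt (fun x : ℝ => log (1 + x)) (1 / (1 + x)) x :=
        ((hasDerivAt_id x).const_add 1).log h1
      convert! (hl.const_mul (log 2)).sub ((hl.pow 2).div_const 2) using 1
      push_cast
      ring) i2
  rw [k3]
  norm_num
  ring

theorem I_el : ∫ t in (0:ℝ)..1, (2 / 25 * (1 / (2 - t) ^ 2) + 8 / 25 * (t / (1 + t ^ 2) ^ 2)
      + 6 / 25 * (1 / (1 + t ^ 2) ^ 2 - 1 / 2 * (1 / (1 + t ^ 2)))) * log t =
      - (3 / 25 * log 2 + 3 * π / 100) := by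
  have := intervalIntegral.integral_eq_sub_of_hasDerivAt_of_le (a := 0) (b := 1)
    (f := fun t : ℝ => 2 / 25 * (1 / 2 * ((t * log t) / (2 - t)) + 1 / 2 * log (2 - t))
      + 8 / 25 * (1 / 2 * (t * (t * log t) / (1 + t ^ 2)) - 1 / 4 * log (1 + t ^ 2))
      + 6 / 25 * (1 / 2 * ((t * log t) / (1 + t ^ 2)) - 1 / 2 * arctan t))
    (f' := fun t => (2 / 25 * (1 / (2 - t) ^ 2) + 8 / 25 * (t / (1 + t ^ 2) ^ 2)
      + 6 / 25 * (1 / (1 + t ^ 2) ^ 2 - 1 / 2 * (1 / (1 + t ^ 2)))) * log t) zero_le_one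
    (by
      have hc := Real.continuous_mul_log
      intro x hx
      have h1 : 2 - x ≠ 0 := by linarith [hx.2]
      have h2 : 1 + x ^ 2 ≠ 0 := by positivity
      have hc' := hc.continuousAt (x := x)
      apply ContinuousAt.continuousWithinAt
      fun_prop (disch := assumption))
    (by
      intro x hx
      have hx0 : x ≠ 0 := hx.1.ne'
      have h1 : 2 - x ≠ 0 := by linarith [hx.2]
      have h2 : 1 + x ^ 2 ≠ 0 := by positivity
      have hid := hasDerivAt_id x
      have dl := hid.mul (Real.hasDerivAt_log hx0)
      have d2 := hid.const_sub 2
      have d3 := (hid.pow 2).const_add 1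
      have := ((((dl.div d2 h1).const_mul (1 / 2)).add ((d2.log h1).const_mul (1 / 2))).const_mul (2 / 25)).add
        (((((hid.mul dl).div d3 h2).const_mul (1 / 2)).sub ((d3.log h2).const_mul (1 / 4))).const_mul (8 / 25))
      have := this.add ((((dl.div d3 h2).const_mul (1 / 2)).sub ((Real.hasDerivAt_arctan x).const_mul (1 / 2))).const_mul (6 / 25))
      convert! this using 1
      simp
      field_simp
      ring)
    (logII (by
      intro x hx
      have h1 : 2 - x ≠ 0 := by linarith [hx.2]
      have h2 : 1 + x ^ 2 ≠ 0 := by positivity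
      have h1 : (2 - x) ^ 2 ≠ 0 := by positivity
      have h3 : (1 + x ^ 2) ^ 2 ≠ 0 := by positivity
      apply ContinuousAt.continuousWithinAt
      fun_prop (disch := assumption)))
  rw [this]
  norm_num
  ring

theorem I_total : ∫ t in (0:ℝ)..1, (t * (1 - t) ^ 2 / ((2 - t) ^ 2 * (1 + t ^ 2) ^ 2)) * log t =
    -(3 * π / 100 - 3 * π ^ 2 / 400 + (3 / 25) * Real.log 2 +
        (9 / 250) * (Real.log 2) ^ 2 - (13 / 125) * catalan') := by
  have cA : ContinuousOn (fun t : ℝ => 1 / (2 - t)) (Set.Icc 0 1) := by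
    intro x hx
    have h1 : 2 - x ≠ 0 := by linarith [hx.2]
    apply ContinuousAt.continuousWithinAt
    fun_prop (disch := assumption)
  have cB : ContinuousOn (fun t : ℝ => 1 / (1 + t ^ 2)) (Set.Icc 0 1) := by
    intro x hx
    have h1 : 1 + x ^ 2 ≠ 0 := by positivity
    apply ContinuousAt.continuousWithinAt
    fun_prop (disch := assumption)
  have cC : ContinuousOn (fun t : ℝ => t / (1 + t ^ 2)) (Set.Icc 0 1) := by
    intro x hx
    have h1 : 1 + x ^ 2 ≠ 0 := by positivity
    apply ContinuousAt.continuousWithinAt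
    fun_prop (disch := assumption)
  have cD : ContinuousOn (fun t : ℝ => 2 / 25 * (1 / (2 - t) ^ 2) + 8 / 25 * (t / (1 + t ^ 2) ^ 2)
      + 6 / 25 * (1 / (1 + t ^ 2) ^ 2 - 1 / 2 * (1 / (1 + t ^ 2)))) (Set.Icc 0 1) := by
    intro x hx
    have h1 : 2 - x ≠ 0 := by linarith [hx.2]
    have h2 : 1 + x ^ 2 ≠ 0 := by positivity
    have h1 : (2 - x) ^ 2 ≠ 0 := by positivity
    have h3 : (1 + x ^ 2) ^ 2 ≠ 0 := by positivity
    apply ContinuousAt.continuousWithinAt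
    fun_prop (disch := assumption)
  have e : ∫ t in (0:ℝ)..1, (t * (1 - t) ^ 2 / ((2 - t) ^ 2 * (1 + t ^ 2) ^ 2)) * log t =
      ∫ t in (0:ℝ)..1, ((((2 / 25 * (1 / (2 - t) ^ 2) + 8 / 25 * (t / (1 + t ^ 2) ^ 2)
        + 6 / 25 * (1 / (1 + t ^ 2) ^ 2 - 1 / 2 * (1 / (1 + t ^ 2)))) * log t
        + (-9 / 125) * (1 / (2 - t) * log t)) + (-9 / 125) * (t / (1 + t ^ 2) * log t))
        + (-13 / 125) * (1 / (1 + t ^ 2) * log t)) := by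
    apply intervalIntegral.integral_congr
    intro x hx
    rw [Set.uIcc_of_le zero_le_one] at hx
    have h1 : 2 - x ≠ 0 := by linarith [hx.2]
    have h2 : 1 + x ^ 2 ≠ 0 := by positivity
    simp only
    field_simp
    ring
  have iA := (logII cA).const_mul (-9 / 125)
  have iB := (logII cB).const_mul (-13 / 125)
  have iC := (logII cC).const_mul (-9 / 125)
  have iD := logII cD
  rw [e, intervalIntegral.integral_add ((iD.add iA).add iC) iB,
    intervalIntegral.integral_add (iD.add iA) iC, intervalIntegral.integral_add iD iA,
    intervalIntegral.integral_const_mul, intervalIntegral.integral_const_mul,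
    intervalIntegral.integral_const_mul, I_el, I_3, I_2, I_G]
  ring

theorem term_eq (k : ℕ) : ((harmonic (3 * k + 1) : ℝ) - (harmonic k : ℝ)) * k /
        ((3 * k + 1) * (Nat.choose (3 * k) k : ℝ) * 2 ^ (k + 1)) =
    ∫ t in (0:ℝ)..1, (-(k / 2 ^ (k + 1)) : ℝ) * ((t ^ k * (1 - t) ^ (2 * k)) * log t) := by
  rw [intervalIntegral.integral_const_mul, int_beta_log, show k + 2 * k + 1 = 3 * k + 1 by ring]
  have h := Nat.choose_mul_factorial_mul_factorial (show k ≤ 3 * k by omega)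
  rw [show 3 * k - k = 2 * k by omega] at h
  rw [Nat.factorial_succ, ← h]
  have h1 := Nat.factorial_ne_zero k
  have h2 := Nat.factorial_ne_zero (2 * k)
  have h3 : Nat.choose (3 * k) k ≠ 0 := (Nat.choose_pos (by omega)).ne'
  push_cast
  field_simp

open MeasureTheory in
theorem main_sum : HasSum (fun k : ℕ =>
      ∫ t in (0:ℝ)..1, (-(k / 2 ^ (k + 1)) : ℝ) * ((t ^ k * (1 - t) ^ (2 * k)) * log t))
    (∫ t in (0:ℝ)..1, -((t * (1 - t) ^ 2 / ((2 - t) ^ 2 * (1 + t ^ 2) ^ 2)) * log t)) := by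
  have hs := (hasSum_coe_mul_geometric_of_norm_lt_one (r := (1 / 2 : ℝ)) (by norm_num))
  apply intervalIntegral.hasSum_integral_of_dominated_convergence
    (fun (k : ℕ) (t : ℝ) => (k * (1 / 2 : ℝ) ^ k) * |log t|)
  · intro n
    apply Measurable.aestronglyMeasurable
    fun_prop
  · intro n
    refine Filter.Eventually.of_forall fun t ht => ?_
    rw [Set.uIoc_of_le zero_le_one] at ht
    have h0 := ht.1
    have h1 : 0 ≤ 1 - t := by linarith [ht.2]
    rw [norm_mul, norm_mul, norm_neg, Real.norm_eq_abs, Real.norm_eq_abs, Real.norm_eq_abs,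
      abs_of_nonneg (show 0 ≤ (n:ℝ) / 2 ^ (n + 1) by positivity),
      abs_of_nonneg (show 0 ≤ t ^ n * (1 - t) ^ (2 * n) by positivity), ← mul_assoc]
    refine mul_le_mul_of_nonneg_right ?_ (abs_nonneg _)
    have a1 : t ^ n * (1 - t) ^ (2 * n) ≤ 1 :=
      mul_le_one₀ (pow_le_one₀ h0.le ht.2) (by positivity) (pow_le_one₀ h1 (by linarith))
    calc (n:ℝ) / 2 ^ (n + 1) * (t ^ n * (1 - t) ^ (2 * n)) ≤ (n:ℝ) / 2 ^ (n + 1) * 1 := by gcongr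
      _ ≤ (n:ℝ) / 2 ^ n := by
        rw [mul_one]
        gcongr
        · norm_num
        · omega
      _ = _ := by rw [one_div, inv_pow]; rfl
  · exact Filter.Eventually.of_forall fun t ht => hs.summable.mul_right _
  · simp_rw [tsum_mul_right]
    exact (intervalIntegral.intervalIntegrable_log').abs.const_mul _
  · refine Filter.Eventually.of_forall fun t ht => ?_
    rw [Set.uIoc_of_le zero_le_one] at ht
    have h0 := ht.1
    have h1 : 0 ≤ 1 - t := by linarith [ht.2]
    have hz : ‖t * (1 - t) ^ 2 / 2‖ < 1 := by
      rw [Real.norm_eq_abs, abs_of_nonneg (by positivity)]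
      have : t * (1 - t) ^ 2 ≤ 1 :=
        mul_le_one₀ ht.2 (by positivity) (pow_le_one₀ h1 (by linarith))
      linarith
    have := (hasSum_coe_mul_geometric_of_norm_lt_one hz).mul_left (-(log t / 2))
    convert! this using 1
    · ext k
      rw [div_pow, mul_pow, ← pow_mul, pow_succ]
      field_simp
    · have h1 : 2 - t ≠ 0 := by linarith [ht.2]
      have h2 : 1 + t ^ 2 ≠ 0 := by positivity
      have h3 : 1 - t * (1 - t) ^ 2 / 2 = (2 - t) * (1 + t ^ 2) / 2 := by ring
      rw [h3]
      field_simp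
      try ring

theorem stmt_13 :
    ∑' k : ℕ, ((harmonic (3 * k + 1) : ℝ) - (harmonic k : ℝ)) * k /
        ((3 * k + 1) * (Nat.choose (3 * k) k : ℝ) * 2 ^ (k + 1)) =
      3 * π / 100 - 3 * π ^ 2 / 400 + (3 / 25) * Real.log 2 +
        (9 / 250) * (Real.log 2) ^ 2 - (13 / 125) * catalan' := by
  simp_rw [term_eq]
  rw [main_sum.tsum_eq, intervalIntegral.integral_neg, I_total]
  ring
end

section
/- The sum over k >= 0 of (H_{3k+1} - H_k) * (k+1) / ((3k+1) * binomial(3k,k) * 2^{k+2}) equals 3π/200 + π²/150 + (3/50)·ln 2 - (4/125)·(ln 2)² + (37/250)·G. -/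
open Real

open MeasureTheory intervalIntegral

lemma ii_log (g : ℝ → ℝ) (hg : ContinuousOn g (Set.Icc 0 1)) :
    IntervalIntegrable (fun x => -Real.log x * g x) volume 0 1 := by
  have h : IntervalIntegrable Real.log volume 0 1 := intervalIntegrable_log'
  have h2 := h.neg
  refine h2.mul_continuousOn ?_
  rwa [Set.uIcc_of_le zero_le_one]

lemma integral_pow_log (m : ℕ) :
    ∫ x in (0:ℝ)..1, -Real.log x * x ^ m = 1 / ((m:ℝ) + 1) ^ 2 := by
  have hm : (m:ℝ) + 1 ≠ 0 := by positivity
  have key := integral_eq_sub_of_hasDerivAt_of_le (a := (0:ℝ)) (b := 1)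
    (f := fun x => -(x * Real.log x) * x ^ m / (m + 1) + x ^ (m + 1) / (m + 1) ^ 2)
    (f' := fun x => -Real.log x * x ^ m) zero_le_one ?_ ?_ (ii_log _ (by fun_prop))
  · rw [key]; simp
  · apply Continuous.continuousOn
    have := Real.continuous_mul_log
    fun_prop
  · intro x hx
    have hx0 : x ≠ 0 := hx.1.ne'
    have h1 := (((hasDerivAt_pow (m + 1) x).fun_mul (Real.hasDerivAt_log hx0)).fun_neg.div_const
      ((m:ℝ) + 1)).fun_add ((hasDerivAt_pow (m + 1) x).div_const (((m:ℝ) + 1) ^ 2))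
    refine (h1.congr_of_eventuallyEq ?_).congr_deriv ?_
    · filter_upwards with y
      ring
    · push_cast
      field_simp
      simp only [pow_succ]
      ring

lemma hasSum_log (F : ℕ → ℝ → ℝ) (g : ℝ → ℝ) (b : ℕ → ℝ) (m : ℕ → ℕ)
    (hF : ∀ n, Continuous (F n))
    (hb : ∀ n, ∀ x ∈ Set.Ioo (0:ℝ) 1, |F n x| ≤ b n * x ^ (m n))
    (hs : Summable fun n => b n * (1 / ((m n : ℝ) + 1) ^ 2))
    (hg : ∀ x ∈ Set.Ioo (0:ℝ) 1, HasSum (fun n => F n x) (g x)) :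
    HasSum (fun n => ∫ x in (0:ℝ)..1, -Real.log x * F n x)
      (∫ x in (0:ℝ)..1, -Real.log x * g x) := by
  have conv : ∀ f : ℝ → ℝ, ∫ x in (0:ℝ)..1, f x = ∫ x in Set.Ioo (0:ℝ) 1, f x := fun f => by
    rw [integral_of_le zero_le_one, integral_Ioc_eq_integral_Ioo]
  have hint : ∀ f : ℝ → ℝ, ContinuousOn f (Set.Icc 0 1) →
      IntegrableOn (fun x => -Real.log x * f x) (Set.Ioo 0 1) := fun f hf =>
    (intervalIntegrable_iff_integrableOn_Ioo_of_le zero_le_one).1 (ii_log f hf)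
  have h1 := hasSum_integral_of_summable_integral_norm
    (μ := volume.restrict (Set.Ioo (0:ℝ) 1)) (F := fun n x => -Real.log x * F n x)
    (fun n => hint _ (hF n).continuousOn) ?_
  · simp only [conv]
    convert! h1 using 1
    refine setIntegral_congr_fun (μ := volume) measurableSet_Ioo fun x hx => ?_
    exact ((hg x hx).mul_left _).tsum_eq.symm
  · refine Summable.of_nonneg_of_le (fun n => integral_nonneg fun x => norm_nonneg _)
      (fun n => ?_) hs
    rw [← integral_pow_log, conv, ← MeasureTheory.integral_const_mul]
    refine setIntegral_mono_on (hint _ (hF n).continuousOn).norm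
      ((hint _ (by fun_prop)).const_mul _) measurableSet_Ioo fun x hx => ?_
    have hl : 0 ≤ -Real.log x := by
      have := Real.log_nonpos hx.1.le hx.2.le
      linarith
    rw [Real.norm_eq_abs, abs_mul, abs_of_nonneg hl]
    calc _ ≤ -Real.log x * (b n * x ^ m n) := mul_le_mul_of_nonneg_left (hb n x hx) hl
      _ = _ := by ring

lemma beta_log (b : ℕ) : ∀ a : ℕ, ∫ x in (0:ℝ)..1, -Real.log x * (x ^ a * (1 - x) ^ b) =
    ((harmonic (a + b + 1) : ℝ) - (harmonic a : ℝ)) *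
      ((a.factorial : ℝ) * b.factorial / (a + b + 1).factorial) := by
  induction b with
  | zero =>
    intro a
    simp only [pow_zero, mul_one, integral_pow_log, add_zero, Nat.factorial_zero, Nat.factorial_succ,
      harmonic_succ]
    push_cast
    have := Nat.cast_ne_zero (R := ℝ).2 (Nat.factorial_ne_zero a)
    field_simp
    ring
  | succ b ih =>
    intro a
    have h : ∀ x : ℝ, -Real.log x * (x ^ a * (1 - x) ^ (b + 1)) =
        -Real.log x * (x ^ a * (1 - x) ^ b) - -Real.log x * (x ^ (a + 1) * (1 - x) ^ b) := by
      intro x; ring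
    simp only [h]
    rw [integral_sub (ii_log _ (by fun_prop)) (ii_log _ (by fun_prop)), ih, ih]
    have e1 : a + 1 + b + 1 = a + b + 1 + 1 := by ring
    have e2 : a + (b + 1) + 1 = a + b + 1 + 1 := by ring
    rw [e1, e2, harmonic_succ (a + b + 1), harmonic_succ a, Nat.factorial_succ (a + b + 1),
      Nat.factorial_succ a, Nat.factorial_succ b]
    push_cast
    have := Nat.cast_ne_zero (R := ℝ).2 (Nat.factorial_ne_zero (a + b + 1))
    have h2 : (a:ℝ) + b + 1 + 1 ≠ 0 := by positivity
    have h3 : (a:ℝ) + 1 ≠ 0 := by positivity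
    field_simp
    ring

lemma summable_sq : Summable fun n : ℕ => 1 / ((n:ℝ) + 1) ^ 2 := by
  have := (summable_nat_add_iff 1).2 hasSum_zeta_two.summable
  simpa using this

lemma alt_sum : ∑' n : ℕ, (-1 : ℝ) ^ n * (1 / ((n:ℝ) + 1) ^ 2) = π ^ 2 / 12 := by
  have hz : HasSum (fun n : ℕ => 1 / ((n:ℝ) + 1) ^ 2) (π ^ 2 / 6) := by
    have := (hasSum_nat_add_iff' 1).2 hasSum_zeta_two
    simpa using this
  have ho := hz.mul_left (1 / 4)
  have hsm : Summable fun n : ℕ => (-1 : ℝ) ^ n * (1 / ((n:ℝ) + 1) ^ 2) := by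
    refine Summable.of_norm ?_
    simpa using summable_sq
  have i1 : Function.Injective fun k : ℕ => 2 * k := fun a b h => by
    simp only at h; omega
  have i2 : Function.Injective fun k : ℕ => 2 * k + 1 := fun a b h => by
    simp only at h; omega
  have b1 : Summable fun k : ℕ => 1 / (((2 * k : ℕ):ℝ) + 1) ^ 2 := hz.summable.comp_injective i1
  have b2 : Summable fun k : ℕ => 1 / (((2 * k + 1 : ℕ):ℝ) + 1) ^ 2 :=
    hz.summable.comp_injective i2
  have a1 := tsum_even_add_odd (f := fun n : ℕ => 1 / ((n:ℝ) + 1) ^ 2) b1 b2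
  have q1 : ∀ k : ℕ, (-1 : ℝ) ^ (2 * k) * (1 / (((2 * k : ℕ):ℝ) + 1) ^ 2) =
      1 / (((2 * k : ℕ):ℝ) + 1) ^ 2 := fun k => by rw [pow_mul]; simp
  have q2 : ∀ k : ℕ, (-1 : ℝ) ^ (2 * k + 1) * (1 / (((2 * k + 1 : ℕ):ℝ) + 1) ^ 2) =
      -(1 / (((2 * k + 1 : ℕ):ℝ) + 1) ^ 2) := fun k => by rw [pow_succ, pow_mul]; simp
  have a2 := tsum_even_add_odd (f := fun n : ℕ => (-1 : ℝ) ^ n * (1 / ((n:ℝ) + 1) ^ 2))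
    (b1.congr fun k => (q1 k).symm) (b2.neg.congr fun k => (q2 k).symm)
  rw [hz.tsum_eq] at a1
  have e1 : ∑' k : ℕ, 1 / (((2 * k + 1 : ℕ) : ℝ) + 1) ^ 2 = 1 / 4 * (π ^ 2 / 6) := by
    rw [← ho.tsum_eq]
    refine tsum_congr fun k => ?_
    push_cast
    rw [show 2 * (k:ℝ) + 1 + 1 = 2 * (k + 1) by ring, mul_pow]
    have : (k:ℝ) + 1 ≠ 0 := by positivity
    field_simp
    norm_num
  rw [tsum_congr q1, tsum_congr q2, tsum_neg, e1] at a2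
  rw [e1] at a1
  rw [← a2]
  linarith

lemma I_one : ∫ x in (0:ℝ)..1, -Real.log x * (1 / (1 + x)) = π ^ 2 / 12 := by
  have h := hasSum_log (fun n x => (-1) ^ n * x ^ n) (fun x => 1 / (1 + x)) (fun _ => 1) (fun n => n)
    (fun n => by fun_prop) (fun n x hx => by simp [abs_of_pos hx.1])
    (by simpa using summable_sq) (fun x hx => by
      have := hasSum_geometric_of_abs_lt_one (r := -x) (by rw [abs_neg, abs_of_pos hx.1]; exact hx.2)
      simp only [← mul_pow]
      simpa using this)
  rw [← h.tsum_eq, ← alt_sum]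
  refine tsum_congr fun n => ?_
  rw [← integral_pow_log, ← intervalIntegral.integral_const_mul]
  congr 1; ext x; ring

lemma I_three : ∫ x in (0:ℝ)..1, -Real.log x * (x / (1 + x ^ 2)) = π ^ 2 / 48 := by
  have h := hasSum_log (fun n x => (-1) ^ n * x ^ (2 * n + 1)) (fun x => x / (1 + x ^ 2))
    (fun _ => 1) (fun n => 2 * n + 1)
    (fun n => by fun_prop) (fun n x hx => by simp [abs_of_pos hx.1])
    (by
      have := summable_sq.mul_left (1 / 4)
      refine this.congr fun n => ?_
      push_cast
      have h3 : 2 * (n:ℝ) + 1 + 1 ≠ 0 := by positivity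
      field_simp
      ring) (fun x hx => by
      have := (hasSum_geometric_of_abs_lt_one (r := -x ^ 2) (by
        rw [abs_neg, abs_of_pos (pow_pos hx.1 2)]
        exact pow_lt_one₀ hx.1.le hx.2 two_ne_zero)).mul_left x
      convert! this using 1
      · ext n; rw [neg_pow (x ^ 2), pow_succ, pow_mul x]; ring
      · rw [sub_neg_eq_add]; rfl)
  rw [← h.tsum_eq, show π ^ 2 / 48 = 1 / 4 * (π ^ 2 / 12) by ring, ← alt_sum, ← tsum_mul_left]
  refine tsum_congr fun n => ?_
  have e : ∀ x : ℝ, -Real.log x * ((-1) ^ n * x ^ (2 * n + 1)) =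
    (-1) ^ n * (-Real.log x * x ^ (2 * n + 1)) := fun x => by ring
  simp only [e]
  rw [intervalIntegral.integral_const_mul, integral_pow_log]
  push_cast
  have h3 : 2 * (n:ℝ) + 1 + 1 ≠ 0 := by positivity
  field_simp
  ring

lemma I_four : ∫ x in (0:ℝ)..1, -Real.log x * (1 / (1 + x ^ 2)) = catalan' := by
  have h := hasSum_log (fun n x => (-1) ^ n * x ^ (2 * n)) (fun x => 1 / (1 + x ^ 2))
    (fun _ => 1) (fun n => 2 * n)
    (fun n => by fun_prop) (fun n x hx => by simp [abs_of_pos hx.1])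
    (by
      refine Summable.of_nonneg_of_le (fun n => by positivity) (fun n => ?_) summable_sq
      push_cast
      rw [one_mul]
      gcongr
      linarith [(Nat.cast_nonneg n : (0:ℝ) ≤ n)]) (fun x hx => by
      have := (hasSum_geometric_of_abs_lt_one (r := -x ^ 2) (by
        rw [abs_neg, abs_of_pos (pow_pos hx.1 2)]
        exact pow_lt_one₀ hx.1.le hx.2 two_ne_zero))
      convert! this using 1
      · ext n; rw [neg_pow (x ^ 2), pow_mul x]
      · rw [sub_neg_eq_add, one_div])
  rw [← h.tsum_eq, catalan']
  refine tsum_congr fun n => ?_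
  have e : ∀ x : ℝ, -Real.log x * ((-1) ^ n * x ^ (2 * n)) =
    (-1) ^ n * (-Real.log x * x ^ (2 * n)) := fun x => by ring
  simp only [e]
  rw [intervalIntegral.integral_const_mul, integral_pow_log]
  push_cast
  ring

lemma I_two : ∫ x in (0:ℝ)..1, -Real.log x * (1 / (2 - x)) =
    π ^ 2 / 12 - (Real.log 2) ^ 2 / 2 := by
  have c1 : ContinuousOn (fun x : ℝ => 1 / (1 + x)) (Set.Icc 0 1) := by
    refine ContinuousOn.div (by fun_prop) (by fun_prop) fun x hx => ?_
    linarith [hx.1]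
  have cl : ContinuousOn (fun x : ℝ => Real.log (1 + x)) (Set.Icc 0 1) := by
    refine ContinuousOn.log (by fun_prop) fun x hx => ?_
    linarith [hx.1]
  have conv : ∀ f : ℝ → ℝ, ∫ x in (0:ℝ)..1, f x = ∫ x in Set.Ioo (0:ℝ) 1, f x := fun f => by
    rw [integral_of_le zero_le_one, integral_Ioc_eq_integral_Ioo]
  have himg : Set.image (fun s : ℝ => 2 * s / (1 + s)) (Set.Ioo 0 1) = Set.Ioo 0 1 := by
    ext y
    constructor
    · rintro ⟨s, hs, rfl⟩
      have h0 := hs.1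
      have h1 := hs.2
      have : 0 < 1 + s := by linarith
      constructor
      · positivity
      · simp only
        rw [div_lt_one this]; linarith
    · intro hy
      have h0 := hy.1
      have h1 := hy.2
      have h2 : 0 < 2 - y := by linarith
      refine ⟨y / (2 - y), ⟨by positivity, by rw [div_lt_one h2]; linarith⟩, ?_⟩
      have : 1 + y / (2 - y) = 2 / (2 - y) := by field_simp; ring
      simp only [this]
      field_simp
  have hcv := integral_image_eq_integral_abs_deriv_smul (s := Set.Ioo (0:ℝ) 1)
    (f := fun s : ℝ => 2 * s / (1 + s)) (f' := fun s => 2 / (1 + s) ^ 2) measurableSet_Ioo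
    (fun s hs => by
      have hs0 : 1 + s ≠ 0 := by linarith [hs.1]
      have h1 := ((hasDerivAt_id s).const_mul 2).fun_div ((hasDerivAt_id s).const_add 1) hs0
      refine (h1.congr_deriv ?_).hasDerivWithinAt
      simp only [id]
      field_simp
      ring)
    (fun s hs t ht h => by
      have hs0 : 1 + s ≠ 0 := by linarith [hs.1]
      have ht0 : 1 + t ≠ 0 := by linarith [ht.1]
      simp only at h
      rw [div_eq_div_iff hs0 ht0] at h
      linarith)
    (fun x => -Real.log x * (1 / (2 - x)))
  rw [himg, ← conv] at hcv
  rw [hcv]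
  have e : ∀ s ∈ Set.Ioo (0:ℝ) 1, |2 / (1 + s) ^ 2| • (-Real.log (2 * s / (1 + s)) *
      (1 / (2 - 2 * s / (1 + s)))) =
      -Real.log s * (1 / (1 + s)) + (Real.log (1 + s) - Real.log 2) * (1 / (1 + s)) := by
    intro s hs
    have h0 := hs.1
    have h1 : 0 < 1 + s := by linarith
    have : 2 - 2 * s / (1 + s) = 2 / (1 + s) := by field_simp; ring
    rw [this, abs_of_pos (by positivity), Real.log_div (by positivity) h1.ne',
      Real.log_mul two_ne_zero h0.ne', smul_eq_mul]
    field_simp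
    ring
  rw [setIntegral_congr_fun measurableSet_Ioo e, ← conv]
  have ii2 : IntervalIntegrable (fun s => (Real.log (1 + s) - Real.log 2) * (1 / (1 + s)))
      volume 0 1 := by
    apply ContinuousOn.intervalIntegrable
    rw [Set.uIcc_of_le zero_le_one]
    exact (cl.sub continuousOn_const).mul c1
  rw [integral_add (ii_log _ c1) ii2, I_one]
  have key := integral_eq_sub_of_hasDerivAt_of_le (a := (0:ℝ)) (b := 1)
    (f := fun s => (Real.log (1 + s) - Real.log 2) ^ 2 / 2) zero_le_one
    (((cl.sub continuousOn_const).pow 2).div_const 2) (fun s hs => by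
      have hs0 : 1 + s ≠ 0 := by linarith [hs.1]
      have h1 := (((((hasDerivAt_id s).const_add 1).log hs0).sub_const (Real.log 2)).fun_pow 2).div_const 2
      refine h1.congr_deriv ?_
      simp
      ring) ii2
  rw [key]
  norm_num
  ring

lemma main_int : ∫ x in (0:ℝ)..1, -Real.log x * (1 / ((2 - x) ^ 2 * (1 + x ^ 2) ^ 2)) =
    3 * π / 200 + π ^ 2 / 150 + (3 / 50) * Real.log 2 -
        (4 / 125) * (Real.log 2) ^ 2 + (37 / 250) * catalan' := by
  have u0 : ∀ x : ℝ, 1 + x ^ 2 ≠ 0 := fun x => by positivity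
  have v0 : ∀ x ∈ Set.Icc (0:ℝ) 1, 2 - x ≠ 0 := fun x hx => by linarith [hx.2]
  have c1 : ContinuousOn (fun x : ℝ => 1 / (2 - x)) (Set.Icc 0 1) :=
    ContinuousOn.div (by fun_prop) (by fun_prop) v0
  have c3 : ContinuousOn (fun x : ℝ => x / (1 + x ^ 2)) (Set.Icc 0 1) :=
    ContinuousOn.div (by fun_prop) (by fun_prop) fun x _ => u0 x
  have c4 : ContinuousOn (fun x : ℝ => 1 / (1 + x ^ 2)) (Set.Icc 0 1) :=
    ContinuousOn.div (by fun_prop) (by fun_prop) fun x _ => u0 x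
  let R : ℝ → ℝ := fun x => 1 / 25 * (1 / (2 - x)) ^ 2 + 4 / 25 * (x / (1 + x ^ 2)) * (1 / (1 + x ^ 2))
    + 3 / 25 * (1 / (1 + x ^ 2)) ^ 2 - 3 / 50 * (1 / (1 + x ^ 2))
  have cR : ContinuousOn R (Set.Icc 0 1) :=
    (((continuousOn_const.mul (c1.pow 2)).add ((continuousOn_const.mul c3).mul c4)).add
      (continuousOn_const.mul (c4.pow 2))).sub (continuousOn_const.mul c4)
  have key := integral_eq_sub_of_hasDerivAt_of_le (a := (0:ℝ)) (b := 1)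
    (f := fun x => -(x * Real.log x) * (1 / 50 * (1 / (2 - x)) + 2 / 25 * (x / (1 + x ^ 2))
      + 3 / 50 * (1 / (1 + x ^ 2))) +
      (-Real.log (2 - x) / 50 + Real.log (1 + x ^ 2) / 25 + 3 / 50 * Real.arctan x))
    (f' := fun x => -Real.log x * R x) zero_le_one ?_ ?_ (ii_log _ cR)
  · have e : ∫ x in (0:ℝ)..1, -Real.log x * (1 / ((2 - x) ^ 2 * (1 + x ^ 2) ^ 2)) =
      ∫ x in (0:ℝ)..1, (-Real.log x * R x + 8 / 125 * (-Real.log x * (1 / (2 - x)))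
        + 8 / 125 * (-Real.log x * (x / (1 + x ^ 2)))
        + 37 / 250 * (-Real.log x * (1 / (1 + x ^ 2)))) := by
      refine integral_congr fun x hx => ?_
      rw [Set.uIcc_of_le zero_le_one] at hx
      have h1 := v0 x hx
      have h2 := u0 x
      have : 1 / ((2 - x) ^ 2 * (1 + x ^ 2) ^ 2) = R x + 8 / 125 * (1 / (2 - x))
        + 8 / 125 * (x / (1 + x ^ 2)) + 37 / 250 * (1 / (1 + x ^ 2)) := by
        simp only [R]
        field_simp
        ring
      simp only [this]
      ring
    rw [e, intervalIntegral.integral_add, intervalIntegral.integral_add, intervalIntegral.integral_add, key, intervalIntegral.integral_const_mul,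
      intervalIntegral.integral_const_mul, intervalIntegral.integral_const_mul, I_two, I_three, I_four]
    · norm_num
      ring
    all_goals
      have j1 := ii_log _ cR
      have j2 := (ii_log _ c1).const_mul (8 / 125)
      have j3 := (ii_log _ c3).const_mul (8 / 125)
      have j4 := (ii_log _ c4).const_mul (37 / 250)
      first
        | exact j1
        | exact j2
        | exact j3
        | exact j4
        | exact j1.add j2
        | exact (j1.add j2).add j3
  · refine ContinuousOn.add (ContinuousOn.mul Real.continuous_mul_log.neg.continuousOn
      (((continuousOn_const.mul c1).add (continuousOn_const.mul c3)).add
        (continuousOn_const.mul c4))) ?_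
    refine ContinuousOn.add (ContinuousOn.add ?_ ?_) ?_
    · exact (ContinuousOn.log (by fun_prop) v0).neg.div_const 50
    · exact (ContinuousOn.log (by fun_prop) (fun x _ => u0 x)).div_const 25
    · exact continuousOn_const.mul Real.continuous_arctan.continuousOn
  · intro x hx
    have hx0 : x ≠ 0 := hx.1.ne'
    have h1 := v0 x ⟨hx.1.le, hx.2.le⟩
    have h2 := u0 x
    have dv := (hasDerivAt_id x).const_sub 2
    have du := (hasDerivAt_pow 2 x).const_add 1
    have d1 := ((hasDerivAt_id x).fun_mul (Real.hasDerivAt_log hx0)).fun_neg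
    have d2 := ((((hasDerivAt_const x (1:ℝ)).fun_div dv h1).const_mul (1 / 50)).fun_add
      (((hasDerivAt_id x).fun_div du h2).const_mul (2 / 25))).fun_add
      (((hasDerivAt_const x (1:ℝ)).fun_div du h2).const_mul (3 / 50))
    have d3 := ((((dv.log h1).fun_neg).div_const 50).fun_add ((du.log h2).div_const 25)).fun_add
      ((Real.hasDerivAt_arctan x).const_mul (3 / 50))
    refine ((d1.fun_mul d2).fun_add d3).congr_deriv ?_
    simp only [R, id]
    field_simp
    ring

theorem stmt_14 :
    ∑' k : ℕ, ((harmonic (3 * k + 1) : ℝ) - (harmonic k : ℝ)) * (k + 1) /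
        ((3 * k + 1) * (Nat.choose (3 * k) k : ℝ) * 2 ^ (k + 2)) =
      3 * π / 200 + π ^ 2 / 150 + (3 / 50) * Real.log 2 -
        (4 / 125) * (Real.log 2) ^ 2 + (37 / 250) * catalan' := by
  rw [← main_int]
  have hgs : HasSum (fun n : ℕ => ((n:ℝ) + 1) * (1 / 2) ^ n) ((1 / (1 - 1 / 2 : ℝ) ^ 2)) := by
    have := hasSum_choose_mul_geometric_of_norm_lt_one (𝕜 := ℝ) 1 (r := 1 / 2) (by norm_num)
    simpa using this
  have h := hasSum_log (fun n x => ((n:ℝ) + 1) / 2 ^ (n + 2) * (x ^ n * (1 - x) ^ (2 * n)))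
    (fun x => 1 / ((2 - x) ^ 2 * (1 + x ^ 2) ^ 2))
    (fun n => ((n:ℝ) + 1) / 2 ^ (n + 2)) (fun n => 0)
    (fun n => by fun_prop)
    (fun n x hx => by
      have h0 := hx.1
      have h1 : 0 < 1 - x := by linarith [hx.2]
      rw [abs_of_pos (by positivity)]
      rw [pow_zero]
      refine mul_le_mul_of_nonneg_left ?_ (by positivity)
      exact mul_le_one₀ (pow_le_one₀ h0.le hx.2.le) (by positivity)
        (pow_le_one₀ h1.le (by linarith)))
    (by
      refine (hgs.summable.mul_left (1 / 4)).congr fun n => ?_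
      simp only [one_div, inv_pow, pow_add]
      norm_num
      ring)
    (fun x hx => by
      have h0 := hx.1
      have h1 : 0 < 1 - x := by linarith [hx.2]
      have hlt : x * (1 - x) ^ 2 ≤ 1 :=
        mul_le_one₀ hx.2.le (by positivity) (pow_le_one₀ h1.le (by linarith))
      have hr : ‖x * (1 - x) ^ 2 / 2‖ < 1 := by
        rw [Real.norm_eq_abs, abs_of_pos (by positivity)]
        linarith
      have := (hasSum_choose_mul_geometric_of_norm_lt_one (𝕜 := ℝ) 1 hr).mul_left (1 / 4)
      convert! this using 1
      · ext n
        rw [div_pow, mul_pow, ← pow_mul, Nat.choose_one_right]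
        push_cast
        rw [pow_add]
        field_simp
        norm_num
      · have : 1 - x * (1 - x) ^ 2 / 2 = (2 - x) * (1 + x ^ 2) / 2 := by ring
        rw [this]
        have h2 : 2 - x ≠ 0 := by linarith
        have h3 : 1 + x ^ 2 ≠ 0 := by positivity
        field_simp
        ring)
  rw [← h.tsum_eq]
  refine tsum_congr fun k => ?_
  have e : ∀ x : ℝ, -Real.log x * (((k:ℝ) + 1) / 2 ^ (k + 2) * (x ^ k * (1 - x) ^ (2 * k))) =
    ((k:ℝ) + 1) / 2 ^ (k + 2) * (-Real.log x * (x ^ k * (1 - x) ^ (2 * k))) := fun x => by ring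
  simp only [e]
  rw [intervalIntegral.integral_const_mul, beta_log, show k + 2 * k + 1 = 3 * k + 1 by ring,
    Nat.factorial_succ]
  have hc := Nat.choose_mul_factorial_mul_factorial (show k ≤ 3 * k by omega)
  rw [show 3 * k - k = 2 * k by omega] at hc
  rw [← hc]
  push_cast
  have f1 := Nat.cast_ne_zero (R := ℝ).2 (Nat.factorial_ne_zero k)
  have f2 := Nat.cast_ne_zero (R := ℝ).2 (Nat.factorial_ne_zero (2 * k))
  have f3 := Nat.cast_ne_zero (R := ℝ).2 (Nat.choose_pos (show k ≤ 3 * k by omega)).ne'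
  field_simp
end
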